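/- Consider a DMC W with finite input alphabet X containing the 'off' symbol 0 and finite output alphabet Y, with Q0 = W(·|0) and supp(Q0) = Y. Suppose there exists a capacity-achieving input distribution whose support is all of X; let Q* denote the capacity-achieving output distribution and C the capacity. Define the vector s on Y by s(y) = Q0(y)·( log(Q*(y)/Q0(y)) + C ). If the system of linear equations Σ_{x∈X, x≠0} α_x ( W(·|x) − Q0 ) = s has a solution with all α_x ≥ 0, then L = √( 2 · var_{Q0}( log( Q0(Y)/Q*(Y) ) ) ). -/

import Mathlib

open Filter
open scoped BigOperators Topology

/-- `p` is a probability mass function on a finite type. -/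
def IsDist {α : Type*} [Fintype α] (p : α → ℝ) : Prop :=
  (∀ a, 0 ≤ p a) ∧ ∑ a, p a = 1

/-- Relative entropy (in nats) between pmfs on a finite type. -/
noncomputable def relEnt {α : Type*} [Fintype α] (p q : α → ℝ) : ℝ :=
  ∑ a, p a * Real.log (p a / q a)

/-- Output distribution on `Y` induced by input distribution `P` through channel `W`. -/
noncomputable def outDist {X Y : Type*} [Fintype X] (P : X → ℝ) (W : X → Y → ℝ) : Y → ℝ :=
  fun y => ∑ x, P x * W x y

/-- Mutual information `I(P, W)`. -/
noncomputable def mutInfo {X Y : Type*} [Fintype X] [Fintype Y] (P : X → ℝ) (W : X → Y → ℝ) : ℝ :=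
  ∑ x, ∑ y, P x * W x y * Real.log (W x y / outDist P W y)

/-- The output distribution on `Y^n` induced by a random code (a distribution `ρ` over
encoder/decoder pairs) together with a uniformly chosen message, through `n` memoryless
uses of the channel `W`. -/
noncomputable def codeOut {X Y : Type*} [Fintype X] [Fintype Y] [DecidableEq Y]
    (W : X → Y → ℝ) {n m : ℕ}
    (ρ : (Fin m → Fin n → X) × ((Fin n → Y) → Fin m) → ℝ) : (Fin n → Y) → ℝ :=
  fun ys => ∑ c, ρ c * ((m : ℝ)⁻¹ * ∑ j, ∏ i, W (c.1 j i) (ys i))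

/-- Average probability of a decoding error of a random code, the message being uniform. -/
noncomputable def codeErr {X Y : Type*} [Fintype X] [Fintype Y] [DecidableEq Y]
    (W : X → Y → ℝ) {n m : ℕ}
    (ρ : (Fin m → Fin n → X) × ((Fin n → Y) → Fin m) → ℝ) : ℝ :=
  ∑ c, ρ c * ((m : ℝ)⁻¹ * ∑ j, ∑ ys : Fin n → Y,
    if c.2 ys = j then 0 else ∏ i, W (c.1 j i) (ys i))

/-- `Kmax W x0 δ ε n` is the maximum of `log |M|` (in nats) over random codes of
blocklength `n` whose induced output distribution `Q^n` satisfies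
`D(Q^n ‖ Q0^{×n}) ≤ δ` (with `Q0 = W(·|x0)`) and whose average error probability
is at most `ε`. -/
noncomputable def Kmax {X Y : Type*} [Fintype X] [Fintype Y] [DecidableEq Y]
    (W : X → Y → ℝ) (x0 : X) (δ ε : ℝ) (n : ℕ) : ℝ :=
  sSup {k : ℝ | ∃ m : ℕ, 0 < m ∧
    ∃ ρ : (Fin m → Fin n → X) × ((Fin n → Y) → Fin m) → ℝ,
      (∀ c, 0 ≤ ρ c) ∧ (∑ c, ρ c) = 1 ∧
      relEnt (codeOut W ρ) (fun ys : Fin n → Y => ∏ i, W x0 (ys i)) ≤ δ ∧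
      codeErr W ρ ≤ ε ∧ k = Real.log m}

/-- `IsL W x0 δ L` says that `L = lim_{ε↓0} liminf_{n→∞} K_n(δ,ε)/√(nδ)`
(as an extended real, so that `L = ⊤` is allowed). -/
noncomputable def IsL {X Y : Type*} [Fintype X] [Fintype Y] [DecidableEq Y]
    (W : X → Y → ℝ) (x0 : X) (δ : ℝ) (L : EReal) : Prop :=
  Tendsto (fun ε : ℝ =>
      liminf (fun n : ℕ => ((Kmax W x0 δ ε n / Real.sqrt (n * δ) : ℝ) : EReal)) atTop)
    (nhdsWithin 0 (Set.Ioi 0)) (nhds L)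



/-- Variance of the function `f` of `Y` when `Y` has distribution `q` on a finite set. -/
noncomputable def varFin {α : Type*} [Fintype α] (q f : α → ℝ) : ℝ :=
  ∑ a, q a * (f a - ∑ a', q a' * f a') ^ 2

section ProductSums

variable {ι A : Type*} [Fintype ι] [DecidableEq ι] [Fintype A]

lemma sum_pi_prod (h : ι → A → ℝ) : ∑ f : ι → A, ∏ i, h i (f i) = ∏ i, ∑ a, h i a := by
  rw [Finset.prod_univ_sum, Fintype.piFinset_univ]

lemma sum_pi_prod_mul_apply (p : ι → A → ℝ) (hp : ∀ i, ∑ a, p i a = 1) (k : ι) (ψ : A → ℝ) :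
    ∑ f : ι → A, (∏ i, p i (f i)) * ψ (f k) = ∑ a, p k a * ψ a := by
  have h1 : ∀ f : ι → A, (∏ i, p i (f i)) * ψ (f k)
      = ∏ i, p i (f i) * (if i = k then ψ (f i) else 1) := by
    intro f
    rw [Finset.prod_mul_distrib, Finset.prod_ite_eq' Finset.univ k]
    simp
  simp_rw [h1]
  rw [sum_pi_prod (fun i a => p i a * (if i = k then ψ a else 1)),
    Finset.prod_eq_single k]
  · simp
  · intro i _ hi
    simp [hi, hp]
  · simp

lemma sum_pi_prod_mul_apply_mul_apply (p : A → ℝ) (hp : ∑ a, p a = 1) {j k : ι} (hjk : j ≠ k)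
    (ψ χ : A → ℝ) :
    ∑ f : ι → A, (∏ i, p (f i)) * (ψ (f j) * χ (f k))
      = (∑ a, p a * ψ a) * ∑ a, p a * χ a := by
  have h1 : ∀ f : ι → A, (∏ i, p (f i)) * (ψ (f j) * χ (f k))
      = ∏ i, p (f i) * (if i = j then ψ (f i) else if i = k then χ (f i) else 1) := by
    intro f
    rw [Finset.prod_mul_distrib]
    congr 1
    rw [Finset.prod_eq_mul j k hjk]
    · simp [hjk.symm]
    · rintro i - ⟨hi, hi'⟩
      simp [hi, hi']
    · simp
    · simp
  simp_rw [h1]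
  rw [sum_pi_prod (fun (i : ι) a => p a * (if i = j then ψ a else if i = k then χ a else 1)),
    Finset.prod_eq_mul j k hjk]
  · simp [hjk.symm]
  · rintro i - ⟨hi, hi'⟩
    simp [hi, hi', hp]
  · simp
  · simp

/-- Relative entropy is additive over products. -/
lemma relEnt_pi_prod (p q : ι → A → ℝ) (hp : ∀ i, ∑ a, p i a = 1) (hq : ∀ i a, 0 < q i a) :
    relEnt (fun f : ι → A => ∏ i, p i (f i)) (fun f => ∏ i, q i (f i))
      = ∑ i, relEnt (p i) (q i) := by
  have h1 : ∀ f : ι → A, (∏ i, p i (f i)) * Real.log ((∏ i, p i (f i)) / ∏ i, q i (f i))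
      = ∑ k, (∏ i, p i (f i)) * Real.log (p k (f k) / q k (f k)) := by
    intro f
    by_cases h0 : ∏ i, p i (f i) = 0
    · simp [h0]
    · rw [← Finset.mul_sum, ← Finset.prod_div_distrib, Real.log_prod]
      intro i _
      exact div_ne_zero (Finset.prod_ne_zero_iff.mp h0 i (Finset.mem_univ i)) (hq i _).ne'
  unfold relEnt
  simp_rw [h1]
  rw [Finset.sum_comm]
  exact Finset.sum_congr rfl fun k _ =>
    sum_pi_prod_mul_apply p hp k fun a => Real.log (p k a / q k a)

end ProductSums

section RelEnt

variable {A : Type*} [Fintype A]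

/-- A linearised form of the Donsker–Varadhan inequality. -/
lemma sum_mul_le_relEnt_add (p q φ : A → ℝ) (hp : IsDist p) (hq : ∀ a, 0 < q a) :
    ∑ a, p a * φ a ≤ relEnt p q + (∑ a, q a * Real.exp (φ a) - 1) := by
  have h1 : ∀ a, p a * φ a ≤ p a * Real.log (p a / q a) + (q a * Real.exp (φ a) - p a) := by
    intro a
    rcases (hp.1 a).eq_or_lt with h | h
    · rw [← h]
      have := mul_pos (hq a) (Real.exp_pos (φ a))
      simp only [zero_mul, zero_add, sub_zero]
      exact this.le
    · have h2 := Real.log_le_sub_one_of_pos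
        (div_pos (mul_pos (hq a) (Real.exp_pos (φ a))) h)
      rw [Real.log_div (mul_pos (hq a) (Real.exp_pos _)).ne' h.ne',
        Real.log_mul (hq a).ne' (Real.exp_pos _).ne', Real.log_exp] at h2
      rw [Real.log_div h.ne' (hq a).ne']
      have h3 := mul_le_mul_of_nonneg_left h2 h.le
      have h4 : p a * (q a * Real.exp (φ a) / p a - 1) = q a * Real.exp (φ a) - p a := by
        field_simp
      linarith
  calc ∑ a, p a * φ a
      ≤ ∑ a, (p a * Real.log (p a / q a) + (q a * Real.exp (φ a) - p a)) :=
        Finset.sum_le_sum fun a _ => h1 a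
    _ = _ := by rw [Finset.sum_add_distrib, Finset.sum_sub_distrib, hp.2, relEnt]

/-- The Donsker–Varadhan inequality. -/
lemma sum_mul_le_relEnt_add_log (p q φ : A → ℝ) (hp : IsDist p) (hq : ∀ a, 0 < q a) :
    ∑ a, p a * φ a ≤ relEnt p q + Real.log (∑ a, q a * Real.exp (φ a)) := by
  have hne : (Finset.univ : Finset A).Nonempty := by
    by_contra h
    have := hp.2
    rw [Finset.not_nonempty_iff_eq_empty.mp h] at this
    simp at this
  set Z := ∑ a, q a * Real.exp (φ a) with hZ
  have hZpos : 0 < Z := Finset.sum_pos (fun a _ => mul_pos (hq a) (Real.exp_pos _)) hne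
  have h := sum_mul_le_relEnt_add p q (fun a => φ a - Real.log Z) hp hq
  have h1 : ∑ a, q a * Real.exp (φ a - Real.log Z) = 1 := by
    simp_rw [Real.exp_sub, Real.exp_log hZpos, ← mul_div_assoc]
    rw [← Finset.sum_div, ← hZ, div_self hZpos.ne']
  rw [h1] at h
  simp_rw [mul_sub] at h
  rw [Finset.sum_sub_distrib, ← Finset.sum_mul, hp.2] at h
  linarith

lemma relEnt_le_chi_sq (p q : A → ℝ) (hp : IsDist p) (hq : IsDist q) (hq0 : ∀ a, 0 < q a) :
    relEnt p q ≤ ∑ a, (p a - q a) ^ 2 / q a := by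
  have h1 : ∀ a, p a * Real.log (p a / q a) ≤ (p a - q a) ^ 2 / q a + (p a - q a) := by
    intro a
    have h2 : (p a - q a) ^ 2 / q a + (p a - q a) = p a * (p a / q a - 1) := by
      have := (hq0 a).ne'
      field_simp
      ring
    rw [h2]
    rcases (hp.1 a).eq_or_lt with h | h
    · simp [← h]
    · exact mul_le_mul_of_nonneg_left
        (Real.log_le_sub_one_of_pos (div_pos h (hq0 a))) h.le
  calc relEnt p q ≤ ∑ a, ((p a - q a) ^ 2 / q a + (p a - q a)) :=
        Finset.sum_le_sum fun a _ => h1 a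
    _ = _ := by rw [Finset.sum_add_distrib, Finset.sum_sub_distrib, hp.2, hq.2]; ring

end RelEnt

section Channel

variable {X Y : Type*} [Fintype X] [Fintype Y]

lemma IsDist.outDist {P : X → ℝ} {W : X → Y → ℝ} (hP : IsDist P) (hW : ∀ x, IsDist (W x)) :
    IsDist (outDist P W) := by
  refine ⟨fun y => Finset.sum_nonneg fun x _ => mul_nonneg (hP.1 x) ((hW x).1 y), ?_⟩
  unfold _root_.outDist
  rw [Finset.sum_comm]
  simp_rw [← Finset.mul_sum, (hW _).2, mul_one, hP.2]

/-- The compensation identity for mutual information. -/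
lemma mutInfo_eq_sub_relEnt (P : X → ℝ) (W : X → Y → ℝ) (R : Y → ℝ) (hP : IsDist P)
    (hW : ∀ x, IsDist (W x)) (hR : ∀ y, 0 < R y) :
    mutInfo P W = ∑ x, P x * relEnt (W x) R - relEnt (outDist P W) R := by
  have h1 : ∀ x y, P x * W x y * Real.log (W x y / outDist P W y)
      = P x * (W x y * Real.log (W x y / R y))
        - P x * W x y * Real.log (outDist P W y / R y) := by
    intro x y
    by_cases h0 : P x * W x y = 0
    · rw [← mul_assoc]; simp [h0]
    · have hw : W x y ≠ 0 := right_ne_zero_of_mul h0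
      have ho : 0 < outDist P W y := by
        refine lt_of_lt_of_le (lt_of_le_of_ne (mul_nonneg (hP.1 x) ((hW x).1 y)) (Ne.symm h0)) ?_
        exact Finset.single_le_sum (f := fun x => P x * W x y)
          (fun x _ => mul_nonneg (hP.1 x) ((hW x).1 y)) (Finset.mem_univ x)
      rw [Real.log_div hw ho.ne', Real.log_div hw (hR y).ne', Real.log_div ho.ne' (hR y).ne']
      ring
  unfold mutInfo relEnt
  simp_rw [h1, Finset.sum_sub_distrib, Finset.mul_sum]
  congr 1
  rw [Finset.sum_comm]
  refine Finset.sum_congr rfl fun y _ => ?_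
  rw [← Finset.sum_mul, outDist]

/-- If a capacity-achieving input distribution has full support, all channel rows have the same
divergence from the capacity-achieving output distribution. -/
lemma relEnt_outDist_eq_capacity (W : X → Y → ℝ) (hW : ∀ x, IsDist (W x)) (P : X → ℝ)
    (hP : IsDist P) (hfull : ∀ x, 0 < P x) (hout : ∀ y, 0 < outDist P W y)
    (hcap : ∀ P' : X → ℝ, IsDist P' → mutInfo P' W ≤ mutInfo P W) (x : X) :
    relEnt (W x) (outDist P W) = mutInfo P W := by
  classical
  set R := outDist P W with hR
  have hRd : IsDist R := hP.outDist hW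
  have hself : relEnt R R = 0 := by
    unfold relEnt
    exact Finset.sum_eq_zero fun y _ => by rw [div_self (hout y).ne', Real.log_one, mul_zero]
  have hC : mutInfo P W = ∑ x, P x * relEnt (W x) R := by
    rw [mutInfo_eq_sub_relEnt P W R hP hW hout, ← hR, hself, sub_zero]
  have hle : ∀ x, relEnt (W x) R ≤ mutInfo P W := by
    intro x
    set K := ∑ y, (W x y - R y) ^ 2 / R y with hK
    have hK0 : 0 ≤ K := Finset.sum_nonneg fun y _ => div_nonneg (sq_nonneg _) (hout y).le
    have key : ∀ t : ℝ, 0 < t → t ≤ 1 → relEnt (W x) R - mutInfo P W ≤ t * K := by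
      intro t ht ht1
      let P' : X → ℝ := fun z => (1 - t) * P z + t * (if z = x then 1 else 0)
      have hP' : IsDist P' := by
        refine ⟨fun z => add_nonneg (mul_nonneg (by linarith) (hP.1 z)) ?_, ?_⟩
        · split_ifs <;> simp [ht.le]
        · simp only [P']
          rw [Finset.sum_add_distrib, ← Finset.mul_sum, ← Finset.mul_sum, hP.2]
          simp
      have hout' : ∀ y, outDist P' W y = (1 - t) * R y + t * W x y := by
        intro y
        simp only [hR, outDist, P', add_mul, Finset.sum_add_distrib, Finset.mul_sum]
        simp [mul_assoc]
      have h1 := hcap P' hP'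
      rw [mutInfo_eq_sub_relEnt P' W R hP' hW hout] at h1
      have h2 : ∑ z, P' z * relEnt (W z) R = (1 - t) * mutInfo P W + t * relEnt (W x) R := by
        rw [hC]
        simp only [P', add_mul, Finset.sum_add_distrib, Finset.mul_sum]
        simp [mul_assoc]
      have h3 := relEnt_le_chi_sq _ R (hP'.outDist hW) hRd hout
      have h4 : ∑ y, (outDist P' W y - R y) ^ 2 / R y = t ^ 2 * K := by
        rw [hK, Finset.mul_sum]
        refine Finset.sum_congr rfl fun y _ => ?_
        rw [hout']
        ring
      rw [h4] at h3
      rw [h2] at h1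
      have h5 : t * (relEnt (W x) R - mutInfo P W) ≤ t * (t * K) := by nlinarith
      exact le_of_mul_le_mul_left h5 ht
    by_contra hlt
    push Not at hlt
    have hd : 0 < relEnt (W x) R - mutInfo P W := by linarith
    set d := relEnt (W x) R - mutInfo P W with hddef
    have h1 := key (min 1 (d / (2 * (K + 1)))) (by positivity) (min_le_left _ _)
    have h2 : min 1 (d / (2 * (K + 1))) * K ≤ d / (2 * (K + 1)) * (K + 1) :=
      mul_le_mul (min_le_right _ _) (by linarith) hK0 (by positivity)
    have h3 : d / (2 * (K + 1)) * (K + 1) = d / 2 := by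
      field_simp
    linarith
  have hsum : ∑ z, P z * (mutInfo P W - relEnt (W z) R) = 0 := by
    simp_rw [mul_sub]
    rw [Finset.sum_sub_distrib, ← Finset.sum_mul, hP.2, ← hC]
    ring
  have h0 := (Finset.sum_eq_zero_iff_of_nonneg
    (fun z _ => mul_nonneg (hP.1 z) (sub_nonneg.mpr (hle z)))).mp hsum x (Finset.mem_univ x)
  rcases mul_eq_zero.mp h0 with h | h
  · exact absurd h (hfull x).ne'
  · linarith

end Channel

section Converse

variable {X Y : Type*} [Fintype Y]

lemma isDist_pi_prod {ι A : Type*} [Fintype ι] [DecidableEq ι] [Fintype A] {p : ι → A → ℝ}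
    (hp : ∀ i, IsDist (p i)) : IsDist (fun f : ι → A => ∏ i, p i (f i)) :=
  ⟨fun f => Finset.prod_nonneg fun i _ => (hp i).1 (f i), by
    rw [sum_pi_prod]; exact Finset.prod_eq_one fun i _ => (hp i).2⟩

/-- Converse bound for one codeword of a deterministic code. -/
lemma log_card_mul_le_of_codeword {W : X → Y → ℝ} {x0 : X} (hW : ∀ x, IsDist (W x))
    (hsupp : ∀ y, 0 < W x0 y) {g : Y → ℝ}
    (hg : ∀ x, relEnt (W x) (W x0) = ∑ y, W x y * g y) {n m : ℕ} (hm : 0 < m)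
    (x : Fin n → X) (dec : (Fin n → Y) → Fin m) (j : Fin m) :
    Real.log m * (1 - ∑ ys : Fin n → Y, if dec ys = j then 0 else ∏ i, W (x i) (ys i))
      ≤ ∑ ys : Fin n → Y, (∏ i, W (x i) (ys i)) * ∑ i, g (ys i)
        + m * ∑ ys : Fin n → Y, if dec ys = j then ∏ i, W x0 (ys i) else 0 := by
  have hp : IsDist fun ys : Fin n → Y => ∏ i, W (x i) (ys i) :=
    isDist_pi_prod fun i => hW (x i)
  have hq : IsDist fun ys : Fin n → Y => ∏ i, W x0 (ys i) := isDist_pi_prod fun _ => hW x0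
  have hq0 : ∀ ys : Fin n → Y, 0 < ∏ i, W x0 (ys i) :=
    fun ys => Finset.prod_pos fun i _ => hsupp (ys i)
  have hm' : (0 : ℝ) < m := by exact_mod_cast hm
  have hdv := sum_mul_le_relEnt_add _ _ (fun ys => if dec ys = j then Real.log m else 0) hp hq0
  have h1 : ∑ ys : Fin n → Y, (∏ i, W (x i) (ys i)) * (if dec ys = j then Real.log m else 0)
      = Real.log m * (1 - ∑ ys : Fin n → Y, if dec ys = j then 0 else ∏ i, W (x i) (ys i)) := by
    rw [← hp.2, ← Finset.sum_sub_distrib, Finset.mul_sum]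
    refine Finset.sum_congr rfl fun ys _ => ?_
    split_ifs <;> ring
  have h2 : relEnt (fun ys : Fin n → Y => ∏ i, W (x i) (ys i)) (fun ys => ∏ i, W x0 (ys i))
      = ∑ ys : Fin n → Y, (∏ i, W (x i) (ys i)) * ∑ i, g (ys i) := by
    rw [relEnt_pi_prod (fun i => W (x i)) (fun _ => W x0) (fun i => (hW (x i)).2)
      (fun _ => hsupp)]
    simp_rw [Finset.mul_sum]
    rw [Finset.sum_comm]
    refine Finset.sum_congr rfl fun i _ => ?_
    rw [sum_pi_prod_mul_apply (fun i => W (x i)) (fun i => (hW (x i)).2) i g, hg]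
  have h3 : ∑ ys : Fin n → Y, (∏ i, W x0 (ys i)) * Real.exp (if dec ys = j then Real.log m else 0)
      - 1 ≤ m * ∑ ys : Fin n → Y, if dec ys = j then ∏ i, W x0 (ys i) else 0 := by
    rw [← hq.2, ← Finset.sum_sub_distrib, Finset.mul_sum]
    refine Finset.sum_le_sum fun ys _ => ?_
    have := hq0 ys
    split_ifs
    · rw [Real.exp_log hm']
      linarith
    · simp
  rw [h1, h2] at hdv
  linarith

variable [Fintype X] [DecidableEq Y]

lemma isDist_codeOut {W : X → Y → ℝ} (hW : ∀ x, IsDist (W x)) {n m : ℕ} (hm : 0 < m)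
    {ρ : (Fin m → Fin n → X) × ((Fin n → Y) → Fin m) → ℝ} (hρ : IsDist ρ) :
    IsDist (codeOut W ρ) := by
  have hprod : ∀ x : Fin n → X, IsDist fun ys : Fin n → Y => ∏ i, W (x i) (ys i) :=
    fun x => isDist_pi_prod fun i => hW (x i)
  refine ⟨fun ys => Finset.sum_nonneg fun c _ => mul_nonneg (hρ.1 c) (mul_nonneg (by positivity)
    (Finset.sum_nonneg fun j _ => (hprod (c.1 j)).1 ys)), ?_⟩
  unfold codeOut
  rw [Finset.sum_comm]
  have h : ∀ c : (Fin m → Fin n → X) × ((Fin n → Y) → Fin m),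
      ∑ ys : Fin n → Y, ρ c * ((m : ℝ)⁻¹ * ∑ j, ∏ i, W (c.1 j i) (ys i)) = ρ c := by
    intro c
    rw [← Finset.mul_sum, ← Finset.mul_sum, Finset.sum_comm]
    simp_rw [(hprod _).2]
    have : (m : ℝ) ≠ 0 := by positivity
    simp [this]
  simp_rw [h, hρ.2]

/-- Converse bound for random codes. -/
lemma one_sub_mul_log_card_le {W : X → Y → ℝ} {x0 : X} (hW : ∀ x, IsDist (W x))
    (hsupp : ∀ y, 0 < W x0 y) {g : Y → ℝ}
    (hg : ∀ x, relEnt (W x) (W x0) = ∑ y, W x y * g y) {n m : ℕ} (hm : 0 < m)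
    {ρ : (Fin m → Fin n → X) × ((Fin n → Y) → Fin m) → ℝ} (hρ : IsDist ρ) {δ ε t : ℝ}
    (hδ : relEnt (codeOut W ρ) (fun ys : Fin n → Y => ∏ i, W x0 (ys i)) ≤ δ)
    (hε : codeErr W ρ ≤ ε) (ht : 0 < t) :
    (1 - ε) * Real.log m
      ≤ 1 + (δ + n * Real.log (∑ y, W x0 y * Real.exp (t * g y))) / t := by
  have hm' : (0 : ℝ) < m := by exact_mod_cast hm
  have hq : IsDist fun ys : Fin n → Y => ∏ i, W x0 (ys i) := isDist_pi_prod fun _ => hW x0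
  have hq0 : ∀ ys : Fin n → Y, 0 < ∏ i, W x0 (ys i) :=
    fun ys => Finset.prod_pos fun i _ => hsupp (ys i)
  have hcode : ∀ c : (Fin m → Fin n → X) × ((Fin n → Y) → Fin m),
      Real.log m * (1 - (m : ℝ)⁻¹ * ∑ j, ∑ ys : Fin n → Y,
          if c.2 ys = j then 0 else ∏ i, W (c.1 j i) (ys i))
        ≤ (m : ℝ)⁻¹ * ∑ j, ∑ ys : Fin n → Y, (∏ i, W (c.1 j i) (ys i)) * ∑ i, g (ys i) + 1 := by
    intro c
    have h := Finset.sum_le_sum fun j (_ : j ∈ Finset.univ) =>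
      log_card_mul_le_of_codeword hW hsupp hg hm (c.1 j) c.2 j
    rw [Finset.sum_add_distrib, ← Finset.mul_sum, ← Finset.mul_sum, Finset.sum_sub_distrib,
      Finset.sum_comm (f := fun j ys => if c.2 ys = j then ∏ i, W x0 (ys i) else 0)] at h
    simp only [Finset.sum_ite_eq, Finset.mem_univ, if_true, hq.2, mul_one, Finset.sum_const,
      Finset.card_univ, Fintype.card_fin, nsmul_eq_mul] at h
    have h2 := mul_le_mul_of_nonneg_left h (inv_pos.mpr hm').le
    rw [mul_add, inv_mul_cancel₀ hm'.ne'] at h2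
    refine le_trans (le_of_eq ?_) h2
    field_simp
  have hsum : Real.log m * (1 - codeErr W ρ)
      ≤ ∑ ys : Fin n → Y, codeOut W ρ ys * ∑ i, g (ys i) + 1 := by
    have h := Finset.sum_le_sum fun c (_ : c ∈ Finset.univ) =>
      mul_le_mul_of_nonneg_left (hcode c) (hρ.1 c)
    simp_rw [mul_add, mul_one] at h
    rw [Finset.sum_add_distrib, hρ.2] at h
    have hl : Real.log m * (1 - codeErr W ρ) = ∑ c, ρ c * (Real.log m * (1 - (m : ℝ)⁻¹ * ∑ j,
        ∑ ys : Fin n → Y, if c.2 ys = j then 0 else ∏ i, W (c.1 j i) (ys i))) := by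
      simp_rw [mul_left_comm (ρ _) (Real.log m)]
      rw [← Finset.mul_sum]
      simp only [mul_sub, mul_one, Finset.sum_sub_distrib, hρ.2, codeErr]
    have hr : ∑ ys : Fin n → Y, codeOut W ρ ys * ∑ i, g (ys i) = ∑ c, ρ c * ((m : ℝ)⁻¹ * ∑ j,
        ∑ ys : Fin n → Y, (∏ i, W (c.1 j i) (ys i)) * ∑ i, g (ys i)) := by
      simp_rw [codeOut, Finset.sum_mul]
      rw [Finset.sum_comm]
      refine Finset.sum_congr rfl fun c _ => ?_
      rw [Finset.sum_comm, Finset.mul_sum, Finset.mul_sum]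
      refine Finset.sum_congr rfl fun ys _ => ?_
      rw [← Finset.sum_mul]
      ring
    rw [hl, hr]
    exact h
  have hdv := sum_mul_le_relEnt_add_log (codeOut W ρ) _ (fun ys => t * ∑ i, g (ys i))
    (isDist_codeOut hW hm hρ) hq0
  have hZ : ∑ ys : Fin n → Y, (∏ i, W x0 (ys i)) * Real.exp (t * ∑ i, g (ys i))
      = (∑ y, W x0 y * Real.exp (t * g y)) ^ n := by
    simp_rw [Finset.mul_sum, Real.exp_sum, ← Finset.prod_mul_distrib]
    rw [sum_pi_prod (fun (_ : Fin n) y => W x0 y * Real.exp (t * g y))]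
    simp
  rw [hZ, Real.log_pow] at hdv
  have hdv' : ∑ ys : Fin n → Y, codeOut W ρ ys * ∑ i, g (ys i)
      ≤ (δ + n * Real.log (∑ y, W x0 y * Real.exp (t * g y))) / t := by
    rw [le_div_iff₀ ht, Finset.sum_mul]
    refine le_trans (le_of_eq (Finset.sum_congr rfl fun ys _ => by ring))
      (hdv.trans (add_le_add_left hδ _))
  have hlog : 0 ≤ Real.log m := Real.log_natCast_nonneg m
  nlinarith [mul_le_mul_of_nonneg_left hε hlog]

end Converse

section RandomCoding

variable {X Y : Type*} [Fintype Y]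

open Classical in
/-- The decoder choosing some codeword whose likelihood ratio against `q` exceeds `T`. -/
noncomputable def thresholdDecoder (W : X → Y → ℝ) (q : Y → ℝ) (T : ℝ) {n m : ℕ} (hm : 0 < m)
    (f : Fin m → Fin n → X) (ys : Fin n → Y) : Fin m :=
  if h : ∃ j, T * ∏ i, q (ys i) < ∏ i, W (f j i) (ys i) then h.choose else ⟨0, hm⟩

lemma thresholdDecoder_error_le {W : X → Y → ℝ} (hW : ∀ x, IsDist (W x)) {q : Y → ℝ}
    (hq : ∀ y, 0 < q y) {T l : ℝ} (hT : 0 < T) (hl : 0 < l) {n m : ℕ} (hm : 0 < m)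
    (f : Fin m → Fin n → X) (ys : Fin n → Y) (j : Fin m) :
    (if thresholdDecoder W q T hm f ys = j then 0 else ∏ i, W (f j i) (ys i))
      ≤ T ^ l * ∏ i, W (f j i) (ys i) * Real.exp (-l * Real.log (W (f j i) (ys i) / q (ys i)))
        + ∑ k ∈ Finset.univ.erase j, (∏ i, W (f j i) (ys i)) * (∏ i, W (f k i) (ys i))
            / (T * ∏ i, q (ys i)) := by
  have hw : ∀ k, 0 ≤ ∏ i, W (f k i) (ys i) :=
    fun k => Finset.prod_nonneg fun i _ => (hW _).1 _
  have hq' : 0 < ∏ i, q (ys i) := Finset.prod_pos fun i _ => hq _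
  have hTq : 0 < T * ∏ i, q (ys i) := mul_pos hT hq'
  have hA : 0 ≤ T ^ l * ∏ i, W (f j i) (ys i) *
      Real.exp (-l * Real.log (W (f j i) (ys i) / q (ys i))) :=
    mul_nonneg (Real.rpow_nonneg hT.le _)
      (Finset.prod_nonneg fun i _ => mul_nonneg ((hW _).1 _) (Real.exp_pos _).le)
  have hterm : ∀ k, 0 ≤ (∏ i, W (f j i) (ys i)) * (∏ i, W (f k i) (ys i))
      / (T * ∏ i, q (ys i)) := fun k => div_nonneg (mul_nonneg (hw j) (hw k)) hTq.le
  have hB := Finset.sum_nonneg fun k (_ : k ∈ Finset.univ.erase j) => hterm k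
  split_ifs with hdec
  · exact add_nonneg hA hB
  by_cases hj : T * ∏ i, q (ys i) < ∏ i, W (f j i) (ys i)
  · have hex : ∃ j, T * ∏ i, q (ys i) < ∏ i, W (f j i) (ys i) := ⟨j, hj⟩
    have hd : thresholdDecoder W q T hm f ys = hex.choose := by
      unfold thresholdDecoder
      rw [dif_pos hex]
    have hs := hex.choose_spec
    rw [← hd] at hs
    have h1 := Finset.single_le_sum (fun k _ => hterm k)
      (Finset.mem_erase.mpr ⟨hdec, Finset.mem_univ _⟩)
    refine le_trans ?_ (h1.trans (le_add_of_nonneg_left hA))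
    rw [le_div_iff₀ hTq]
    exact mul_le_mul_of_nonneg_left hs.le (hw j)
  · push Not at hj
    refine le_trans ?_ (le_add_of_nonneg_right hB)
    rcases (hw j).eq_or_lt with h0 | h0
    · rw [← h0]; exact hA
    · have hne := fun i => Finset.prod_ne_zero_iff.mp h0.ne' i (Finset.mem_univ i)
      have hpos : ∀ i, 0 < W (f j i) (ys i) := fun i =>
        lt_of_le_of_ne ((hW _).1 _) (hne i).symm
      have h2 : ∏ i, W (f j i) (ys i) * Real.exp (-l * Real.log (W (f j i) (ys i) / q (ys i)))
          = (∏ i, W (f j i) (ys i)) *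
            ((∏ i, q (ys i)) / ∏ i, W (f j i) (ys i)) ^ l := by
        rw [Finset.prod_mul_distrib, ← Finset.prod_div_distrib,
          ← Real.finsetProd_rpow _ _ (fun i _ => (div_pos (hq _) (hpos i)).le)]
        congr 1
        refine Finset.prod_congr rfl fun i _ => ?_
        rw [Real.rpow_def_of_pos (div_pos (hq _) (hpos i)), ← inv_div, Real.log_inv]
        congr 1
        ring
      rw [h2, mul_left_comm, ← Real.mul_rpow hT.le (div_pos hq' h0).le]
      refine le_mul_of_one_le_right (hw j) (Real.one_le_rpow ?_ hl.le)
      rw [← mul_div_assoc, one_le_div h0]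
      exact hj

variable [Fintype X] [DecidableEq Y]

/-- Existence of random codes: the codewords are i.i.d. and the decoder is a threshold test. -/
lemma exists_random_code {W : X → Y → ℝ} (hW : ∀ x, IsDist (W x)) {q : Y → ℝ}
    (hq : ∀ y, 0 < q y) {P : X → ℝ} (hP : IsDist P) {T l : ℝ} (hT : 0 < T) (hl : 0 < l)
    (n : ℕ) {m : ℕ} (hm : 0 < m) :
    ∃ ρ : (Fin m → Fin n → X) × ((Fin n → Y) → Fin m) → ℝ, IsDist ρ ∧
      (codeOut W ρ = fun ys => ∏ i, outDist P W (ys i)) ∧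
      codeErr W ρ ≤ T ^ l * (∑ x, P x * ∑ y, W x y * Real.exp (-l * Real.log (W x y / q y))) ^ n
        + m / T * (∑ y, outDist P W y ^ 2 / q y) ^ n := by
  classical
  have hm' : (0 : ℝ) < m := by exact_mod_cast hm
  let dec : (Fin m → Fin n → X) → (Fin n → Y) → Fin m := thresholdDecoder W q T hm
  let Pn : (Fin n → X) → ℝ := fun x => ∏ i, P (x i)
  let μ : (Fin m → Fin n → X) → ℝ := fun f => ∏ j, Pn (f j)
  have hPn : IsDist Pn := isDist_pi_prod fun _ => hP
  have hμ : IsDist μ := isDist_pi_prod fun _ => hPn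
  let ρ : (Fin m → Fin n → X) × ((Fin n → Y) → Fin m) → ℝ :=
    fun c => if c.2 = dec c.1 then μ c.1 else 0
  have hρ : ∀ F : (Fin m → Fin n → X) × ((Fin n → Y) → Fin m) → ℝ,
      ∑ c, ρ c * F c = ∑ f, μ f * F (f, dec f) := by
    intro F
    rw [Fintype.sum_prod_type]
    refine Finset.sum_congr rfl fun f _ => ?_
    simp [ρ]
  have hWn : ∀ ys : Fin n → Y, ∑ x, Pn x * ∏ i, W (x i) (ys i) = ∏ i, outDist P W (ys i) := by
    intro ys
    simp only [Pn, ← Finset.prod_mul_distrib, outDist]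
    rw [sum_pi_prod (fun i x => P x * W x (ys i))]
  have havg : ∀ F : (Fin m → Fin n → X) → Fin m → ℝ,
      ∑ f, μ f * ((m : ℝ)⁻¹ * ∑ j, F f j) = (m : ℝ)⁻¹ * ∑ j, ∑ f, μ f * F f j := by
    intro F
    rw [Finset.sum_comm, Finset.mul_sum]
    refine Finset.sum_congr rfl fun f _ => ?_
    rw [← Finset.mul_sum]
    ring
  refine ⟨ρ, ⟨?_, ?_⟩, ?_, ?_⟩
  · intro c
    simp only [ρ]
    split_ifs
    · exact hμ.1 _
    · exact le_rfl
  · have := hρ fun _ => 1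
    simp only [mul_one] at this
    rw [this, hμ.2]
  · funext ys
    unfold codeOut
    rw [hρ]
    have h1 : ∀ j, ∑ f, μ f * ∏ i, W (f j i) (ys i) = ∏ i, outDist P W (ys i) := by
      intro j
      rw [← hWn]
      exact sum_pi_prod_mul_apply (fun _ => Pn) (fun _ => hPn.2) j
        fun x => ∏ i, W (x i) (ys i)
    rw [havg]
    simp_rw [h1]
    simp [hm'.ne']
  · unfold codeErr
    rw [hρ]
    set A := ∑ x, P x * ∑ y, W x y * Real.exp (-l * Real.log (W x y / q y)) with hA
    set S := ∑ y, outDist P W y ^ 2 / q y with hS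
    have hS0 : 0 ≤ S := Finset.sum_nonneg fun y _ => div_nonneg (sq_nonneg _) (hq y).le
    have hmiss : ∀ j, ∑ f, μ f * ∑ ys : Fin n → Y, T ^ l * ∏ i, W (f j i) (ys i) *
        Real.exp (-l * Real.log (W (f j i) (ys i) / q (ys i))) = T ^ l * A ^ n := by
      intro j
      rw [sum_pi_prod_mul_apply (fun _ => Pn) (fun _ => hPn.2) j fun x => ∑ ys : Fin n → Y,
        T ^ l * ∏ i, W (x i) (ys i) * Real.exp (-l * Real.log (W (x i) (ys i) / q (ys i)))]
      have h1 : ∀ x : Fin n → X, ∑ ys : Fin n → Y, T ^ l * ∏ i, W (x i) (ys i) *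
          Real.exp (-l * Real.log (W (x i) (ys i) / q (ys i)))
          = T ^ l * ∏ i, ∑ y, W (x i) y * Real.exp (-l * Real.log (W (x i) y / q y)) := by
        intro x
        rw [← Finset.mul_sum,
          sum_pi_prod fun i y => W (x i) y * Real.exp (-l * Real.log (W (x i) y / q y))]
      simp_rw [h1, mul_left_comm (Pn _)]
      rw [← Finset.mul_sum]
      simp only [Pn, ← Finset.prod_mul_distrib]
      rw [sum_pi_prod fun (_ : Fin n) x =>
        P x * ∑ y, W x y * Real.exp (-l * Real.log (W x y / q y))]
      simp [hA]
    have hfalse : ∀ j k, j ≠ k → ∑ f, μ f * ∑ ys : Fin n → Y,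
        (∏ i, W (f j i) (ys i)) * (∏ i, W (f k i) (ys i)) / (T * ∏ i, q (ys i))
        = S ^ n / T := by
      intro j k hjk
      simp_rw [Finset.mul_sum]
      rw [Finset.sum_comm]
      have h1 : ∀ ys : Fin n → Y, ∑ f, μ f * ((∏ i, W (f j i) (ys i)) *
          (∏ i, W (f k i) (ys i)) / (T * ∏ i, q (ys i)))
          = (∏ i, outDist P W (ys i) ^ 2 / q (ys i)) / T := by
        intro ys
        simp_rw [← mul_div_assoc]
        rw [← Finset.sum_div, sum_pi_prod_mul_apply_mul_apply Pn hPn.2 hjk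
          (fun x => ∏ i, W (x i) (ys i)) (fun x => ∏ i, W (x i) (ys i)), hWn,
          Finset.prod_div_distrib, Finset.prod_pow, div_div, mul_comm T, sq]
      simp_rw [h1]
      rw [← Finset.sum_div, sum_pi_prod fun (_ : Fin n) y => outDist P W y ^ 2 / q y]
      simp [hS]
    have hj : ∀ j, ∑ f, μ f * ∑ ys : Fin n → Y,
        (if dec f ys = j then 0 else ∏ i, W (f j i) (ys i))
        ≤ T ^ l * A ^ n + m / T * S ^ n := by
      intro j
      have h1 : ∑ f, μ f * ∑ ys : Fin n → Y,
          (if dec f ys = j then 0 else ∏ i, W (f j i) (ys i))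
          ≤ ∑ f, (μ f * ∑ ys : Fin n → Y, T ^ l * ∏ i, W (f j i) (ys i) *
              Real.exp (-l * Real.log (W (f j i) (ys i) / q (ys i)))
            + ∑ k ∈ Finset.univ.erase j, μ f * ∑ ys : Fin n → Y,
              (∏ i, W (f j i) (ys i)) * (∏ i, W (f k i) (ys i)) / (T * ∏ i, q (ys i))) := by
        refine Finset.sum_le_sum fun f _ => ?_
        rw [← Finset.mul_sum (Finset.univ.erase j) _ (μ f), ← mul_add, Finset.sum_comm, ← Finset.sum_add_distrib]
        exact mul_le_mul_of_nonneg_left (Finset.sum_le_sum fun ys _ =>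
          thresholdDecoder_error_le hW hq hT hl hm f ys j) (hμ.1 f)
      refine h1.trans ?_
      rw [Finset.sum_add_distrib, hmiss, Finset.sum_comm,
        Finset.sum_congr rfl fun k hk => hfalse j k (Finset.ne_of_mem_erase hk).symm,
        Finset.sum_const, nsmul_eq_mul]
      refine add_le_add_right ?_ _
      rw [div_mul_eq_mul_div, mul_div_assoc]
      refine mul_le_mul_of_nonneg_right ?_ (div_nonneg (pow_nonneg hS0 n) hT.le)
      have hcard : (Finset.univ.erase j).card ≤ m := by
        simpa only [Finset.card_univ, Fintype.card_fin] using
          Finset.card_le_card (Finset.erase_subset j Finset.univ)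
      exact_mod_cast hcard
    rw [havg]
    have h2 := mul_le_mul_of_nonneg_left
      (Finset.sum_le_sum fun j (_ : j ∈ Finset.univ) => hj j) (inv_pos.mpr hm').le
    rw [Finset.sum_const, Finset.card_univ, Fintype.card_fin, nsmul_eq_mul,
      inv_mul_cancel_left₀ hm'.ne'] at h2
    exact h2

end RandomCoding

section Upper

lemma exp_le_quadratic_add_cube {x : ℝ} (hx : |x| ≤ 1) :
    Real.exp x ≤ 1 + x + x ^ 2 / 2 + |x| ^ 3 := by
  have h := (abs_le.mp (Real.exp_bound hx (n := 3) (by norm_num))).2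
  simp only [Finset.sum_range_succ, Finset.sum_range_zero, Nat.factorial] at h
  norm_num at h
  have : 0 ≤ |x| ^ 3 := by positivity
  linarith

lemma one_add_mul_log_le {u : ℝ} (hu : |u| ≤ 1 / 2) :
    (1 + u) * Real.log (1 + u) ≤ u + u ^ 2 / 2 + 4 * |u| ^ 3 := by
  have h := (abs_le.mp (Real.abs_log_sub_add_sum_range_le (x := -u)
    (by rw [abs_neg]; linarith) 2)).2
  simp only [Finset.sum_range_succ, Finset.sum_range_zero, abs_neg, sub_neg_eq_add] at h
  norm_num at h
  have h3 : 0 ≤ |u| ^ 3 := by positivity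
  have h1 : |u| ^ 3 / (1 - |u|) ≤ 2 * |u| ^ 3 := by
    rw [div_le_iff₀ (by linarith)]
    nlinarith
  have hlog : Real.log (1 + u) ≤ u - u ^ 2 / 2 + 2 * |u| ^ 3 := by linarith
  have hu' := abs_le.mp hu
  have h4 := mul_le_mul_of_nonneg_left hlog (by linarith : (0 : ℝ) ≤ 1 + u)
  have h5 : -|u| ^ 3 ≤ u ^ 3 := by rw [← abs_pow]; exact neg_abs_le _
  nlinarith [mul_nonneg h3 (by linarith : (0 : ℝ) ≤ 1 / 2 - u)]

variable {X Y : Type*} [Fintype X] [Fintype Y]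

/-- Second-order bound on the moment generating function of a centred variable. -/
lemma sum_mul_exp_le {q g : Y → ℝ} (hq : IsDist q) (hE : ∑ y, q y * g y = 0) {t : ℝ}
    (ht : 0 ≤ t) (htg : ∀ y, t * |g y| ≤ 1) :
    ∑ y, q y * Real.exp (t * g y)
      ≤ 1 + t ^ 2 * (∑ y, q y * g y ^ 2) / 2 + t ^ 3 * ∑ y, q y * |g y| ^ 3 := by
  have h1 : ∀ y, q y * Real.exp (t * g y) ≤
      q y + t * (q y * g y) + t ^ 2 / 2 * (q y * g y ^ 2) + t ^ 3 * (q y * |g y| ^ 3) := by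
    intro y
    have ha : |t * g y| = t * |g y| := by rw [abs_mul, abs_of_nonneg ht]
    have h := exp_le_quadratic_add_cube (x := t * g y) (ha ▸ htg y)
    rw [ha] at h
    refine (mul_le_mul_of_nonneg_left h (hq.1 y)).trans (le_of_eq (by ring))
  refine (Finset.sum_le_sum fun y _ => h1 y).trans (le_of_eq ?_)
  simp only [Finset.sum_add_distrib, ← Finset.mul_sum, hq.2, hE]
  ring

lemma one_le_sum_mul_exp {q g : Y → ℝ} (hq : IsDist q) (hE : ∑ y, q y * g y = 0) (t : ℝ) :
    1 ≤ ∑ y, q y * Real.exp (t * g y) := by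
  have h1 : ∑ y, (q y + t * (q y * g y)) = 1 := by
    rw [Finset.sum_add_distrib, ← Finset.mul_sum, hq.2, hE, mul_zero, add_zero]
  rw [← h1]
  refine Finset.sum_le_sum fun y _ => ?_
  have := mul_le_mul_of_nonneg_left (Real.add_one_le_exp (t * g y)) (hq.1 y)
  linarith

/-- A function on a finite type times a null sequence is eventually small. -/
lemma eventually_mul_abs_le (g : Y → ℝ) {a : ℕ → ℝ} (ha : Tendsto a atTop (𝓝 0)) {c : ℝ}
    (hc : 0 < c) : ∀ᶠ n in atTop, ∀ y, a n * |g y| ≤ c := by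
  rw [eventually_all]
  intro y
  have h := ha.mul_const |g y|
  rw [zero_mul] at h
  exact (h.eventually_lt_const hc).mono fun n hn => hn.le

lemma tendsto_const_div_sqrt_natCast (c : ℝ) :
    Tendsto (fun n : ℕ => c / Real.sqrt n) atTop (𝓝 0) :=
  tendsto_const_nhds.div_atTop (Real.tendsto_sqrt_atTop.comp tendsto_natCast_atTop_atTop)

variable [DecidableEq Y]

lemma le_of_mem_codeSizes {W : X → Y → ℝ} {x0 : X} (hW : ∀ x, IsDist (W x))
    (hsupp : ∀ y, 0 < W x0 y) {g : Y → ℝ}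
    (hg : ∀ x, relEnt (W x) (W x0) = ∑ y, W x y * g y) {δ ε t : ℝ} (hε : ε < 1) (ht : 0 < t)
    (n : ℕ) {k : ℝ} (hk : ∃ m : ℕ, 0 < m ∧
      ∃ ρ : (Fin m → Fin n → X) × ((Fin n → Y) → Fin m) → ℝ,
        (∀ c, 0 ≤ ρ c) ∧ (∑ c, ρ c) = 1 ∧
        relEnt (codeOut W ρ) (fun ys : Fin n → Y => ∏ i, W x0 (ys i)) ≤ δ ∧
        codeErr W ρ ≤ ε ∧ k = Real.log m) :
    k ≤ (1 + (δ + n * Real.log (∑ y, W x0 y * Real.exp (t * g y))) / t) / (1 - ε) := by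
  obtain ⟨m, hm, ρ, h0, h1, hrel, herr, rfl⟩ := hk
  rw [le_div_iff₀ (by linarith), mul_comm]
  exact one_sub_mul_log_card_le hW hsupp hg hm ⟨h0, h1⟩ hrel herr ht

lemma Kmax_le {W : X → Y → ℝ} {x0 : X} (hW : ∀ x, IsDist (W x)) (hsupp : ∀ y, 0 < W x0 y)
    {g : Y → ℝ} (hg : ∀ x, relEnt (W x) (W x0) = ∑ y, W x y * g y)
    (hE : ∑ y, W x0 y * g y = 0) {δ ε t : ℝ} (hδ : 0 < δ) (hε : ε < 1) (ht : 0 < t) (n : ℕ) :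
    Kmax W x0 δ ε n
      ≤ (1 + (δ + n * Real.log (∑ y, W x0 y * Real.exp (t * g y))) / t) / (1 - ε) := by
  refine Real.sSup_le (fun k hk => le_of_mem_codeSizes hW hsupp hg hε ht n hk) ?_
  have := Real.log_nonneg (one_le_sum_mul_exp (hW x0) hE t)
  have : 0 < 1 - ε := by linarith
  positivity

lemma liminf_Kmax_le {W : X → Y → ℝ} {x0 : X} (hW : ∀ x, IsDist (W x))
    (hsupp : ∀ y, 0 < W x0 y) {g : Y → ℝ}
    (hg : ∀ x, relEnt (W x) (W x0) = ∑ y, W x y * g y)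
    (hE : ∑ y, W x0 y * g y = 0) {δ ε u : ℝ} (hδ : 0 < δ) (hε : ε < 1) (hu : 0 < u) :
    liminf (fun n : ℕ => ((Kmax W x0 δ ε n / Real.sqrt (n * δ) : ℝ) : EReal)) atTop
      ≤ (((1 / u + u * (∑ y, W x0 y * g y ^ 2) / 2) / (1 - ε) : ℝ) : EReal) := by
  set v := ∑ y, W x0 y * g y ^ 2 with hv
  set M := ∑ y, W x0 y * |g y| ^ 3 with hM
  have hd : 0 < Real.sqrt δ := Real.sqrt_pos.mpr hδ
  have hε' : 0 < 1 - ε := by linarith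
  have hbound : ∀ᶠ n : ℕ in atTop, Kmax W x0 δ ε n / Real.sqrt (n * δ)
      ≤ (1 / u + u * v / 2 + ((1 + u ^ 2 * δ * M) / Real.sqrt δ) / Real.sqrt n) / (1 - ε) := by
    filter_upwards [eventually_mul_abs_le g (tendsto_const_div_sqrt_natCast (u * Real.sqrt δ))
      one_pos, eventually_gt_atTop 0] with n hn hn0
    have hn' : (0 : ℝ) < n := by exact_mod_cast hn0
    have hs : 0 < Real.sqrt n := Real.sqrt_pos.mpr hn'
    have ht : 0 < u * Real.sqrt δ / Real.sqrt n := by positivity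
    have hZ1 := one_le_sum_mul_exp (hW x0) hE (u * Real.sqrt δ / Real.sqrt n)
    have hZ := sum_mul_exp_le (hW x0) hE ht.le hn
    have hlog := Real.log_le_sub_one_of_pos (lt_of_lt_of_le one_pos hZ1)
    have hK := Kmax_le hW hsupp hg hE hδ hε ht n
    rw [Real.sqrt_mul hn'.le, div_le_iff₀ (by positivity)]
    refine hK.trans ?_
    rw [div_mul_eq_mul_div]
    refine div_le_div_of_nonneg_right ?_ hε'.le
    have h1 : (δ + n * Real.log (∑ y, W x0 y * Real.exp (u * Real.sqrt δ / Real.sqrt n * g y)))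
        / (u * Real.sqrt δ / Real.sqrt n) ≤ (δ + n * ((u * Real.sqrt δ / Real.sqrt n) ^ 2 * v / 2 +
          (u * Real.sqrt δ / Real.sqrt n) ^ 3 * M)) / (u * Real.sqrt δ / Real.sqrt n) := by
      refine div_le_div_of_nonneg_right (add_le_add_right
        (mul_le_mul_of_nonneg_left ?_ hn'.le) _) ht.le
      linarith
    refine (add_le_add_right h1 1).trans (le_of_eq ?_)
    have e1 : δ = Real.sqrt δ ^ 2 := (Real.sq_sqrt hδ.le).symm
    have e2 : (n : ℝ) = Real.sqrt n ^ 2 := (Real.sq_sqrt hn'.le).symm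
    generalize Real.sqrt δ = d at *
    generalize Real.sqrt n = s at *
    rw [e1, e2]
    field_simp
    ring
  have hlim : Tendsto (fun n : ℕ => (((1 / u + u * v / 2 +
      ((1 + u ^ 2 * δ * M) / Real.sqrt δ) / Real.sqrt n) / (1 - ε) : ℝ) : EReal)) atTop
      (𝓝 (((1 / u + u * v / 2) / (1 - ε) : ℝ) : EReal)) := by
    refine (continuous_coe_real_ereal.tendsto _).comp ?_
    have := ((tendsto_const_div_sqrt_natCast ((1 + u ^ 2 * δ * M) / Real.sqrt δ)).const_add
      (1 / u + u * v / 2)).div_const (1 - ε)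
    rwa [add_zero] at this
  rw [← hlim.liminf_eq]
  exact liminf_le_liminf (hbound.mono fun n hn => EReal.coe_le_coe_iff.mpr hn)

end Upper

section Lower

variable {X Y : Type*} [Fintype X] [Fintype Y] [DecidableEq X]

/-- The input distribution that perturbs the point mass at `x0` by `η` in direction `α`. -/
noncomputable def perturbedInput (x0 : X) (α : X → ℝ) (η : ℝ) : X → ℝ :=
  fun x => if x = x0 then 1 - η * ∑ z ∈ Finset.univ.erase x0, α z else η * α x

lemma sum_perturbedInput_mul (x0 : X) (α : X → ℝ) (η : ℝ) (F : X → ℝ) :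
    ∑ x, perturbedInput x0 α η x * F x
      = F x0 + η * ∑ x ∈ Finset.univ.erase x0, α x * (F x - F x0) := by
  rw [← Finset.add_sum_erase _ _ (Finset.mem_univ x0)]
  have h : ∑ x ∈ Finset.univ.erase x0, perturbedInput x0 α η x * F x
      = ∑ x ∈ Finset.univ.erase x0, η * α x * F x :=
    Finset.sum_congr rfl fun x hx => by
      rw [perturbedInput, if_neg (Finset.ne_of_mem_erase hx)]
  rw [h, perturbedInput, if_pos rfl]
  simp only [mul_sub, Finset.sum_sub_distrib, ← Finset.sum_mul, mul_assoc, ← Finset.mul_sum]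
  ring

lemma isDist_perturbedInput (x0 : X) {α : X → ℝ} (hα : ∀ x, 0 ≤ α x) {η : ℝ} (hη : 0 ≤ η)
    (h1 : η * ∑ z ∈ Finset.univ.erase x0, α z ≤ 1) : IsDist (perturbedInput x0 α η) := by
  refine ⟨fun x => ?_, ?_⟩
  · unfold perturbedInput
    split_ifs
    · linarith
    · exact mul_nonneg hη (hα x)
  · have := sum_perturbedInput_mul x0 α η fun _ => 1
    simpa using this

lemma relEnt_tilt_le {q g : Y → ℝ} (hq : IsDist q) (hq0 : ∀ y, 0 < q y)
    (hE : ∑ y, q y * g y = 0) {η : ℝ} (hη : 0 ≤ η) (hηg : ∀ y, η * |g y| ≤ 1 / 2) :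
    relEnt (fun y => q y * (1 + η * g y)) q
      ≤ η ^ 2 * (∑ y, q y * g y ^ 2) / 2 + 4 * η ^ 3 * ∑ y, q y * |g y| ^ 3 := by
  have h1 : ∀ y, q y * (1 + η * g y) * Real.log (q y * (1 + η * g y) / q y) ≤
      η * (q y * g y) + η ^ 2 / 2 * (q y * g y ^ 2) + 4 * η ^ 3 * (q y * |g y| ^ 3) := by
    intro y
    have ha : |η * g y| = η * |g y| := by rw [abs_mul, abs_of_nonneg hη]
    have h := one_add_mul_log_le (u := η * g y) (ha ▸ hηg y)
    rw [ha] at h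
    rw [mul_div_cancel_left₀ _ (hq0 y).ne', mul_assoc]
    exact (mul_le_mul_of_nonneg_left h (hq.1 y)).trans (le_of_eq (by ring))
  refine (Finset.sum_le_sum fun y _ => h1 y).trans (le_of_eq ?_)
  simp only [Finset.sum_add_distrib, ← Finset.mul_sum, hE]
  ring

lemma hasDerivAt_sum_mul_exp_log (p q : Y → ℝ) :
    HasDerivAt (fun l : ℝ => ∑ y, p y * Real.exp (-l * Real.log (p y / q y)))
      (-relEnt p q) 0 := by
  have h : ∀ y ∈ Finset.univ, HasDerivAt
      (fun l : ℝ => p y * Real.exp (-l * Real.log (p y / q y)))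
      (-(p y * Real.log (p y / q y))) 0 := by
    intro y _
    have h1 : HasDerivAt (fun l : ℝ => -l * Real.log (p y / q y))
        (-1 * Real.log (p y / q y)) 0 := (hasDerivAt_id (0 : ℝ)).neg.mul_const _
    refine (h1.exp.const_mul (p y)).congr_deriv ?_
    simp
  have := HasDerivAt.fun_sum h
  rwa [Finset.sum_neg_distrib] at this

/-- Small tilting parameters make the Chernoff exponent as close as desired to first order. -/
lemma exists_pos_mul_lt_chernoff {W : X → Y → ℝ} (hW : ∀ x, IsDist (W x)) (x0 : X) (α : X → ℝ)
    {κ r v : ℝ} (hv : ∑ x ∈ Finset.univ.erase x0, α x * relEnt (W x) (W x0) = v)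
    (hr : r < κ * v) :
    ∃ l : ℝ, 0 < l ∧ l * r < κ * ∑ x ∈ Finset.univ.erase x0,
      α x * (1 - ∑ y, W x y * Real.exp (-l * Real.log (W x y / W x0 y))) := by
  have hB : HasDerivAt (fun l : ℝ => κ * ∑ x ∈ Finset.univ.erase x0,
      α x * (1 - ∑ y, W x y * Real.exp (-l * Real.log (W x y / W x0 y)))) (κ * v) 0 := by
    have h := HasDerivAt.fun_sum fun x (_ : x ∈ Finset.univ.erase x0) =>
      ((hasDerivAt_sum_mul_exp_log (W x) (W x0)).const_sub 1).const_mul (α x)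
    simp only [neg_neg] at h
    rw [hv] at h
    exact h.const_mul κ
  have hslope := (hasDerivAt_iff_tendsto_slope.mp hB).mono_left
    (nhdsWithin_mono 0 fun l (hl : l ∈ Set.Ioi (0 : ℝ)) => ne_of_gt hl)
  obtain ⟨l, hl, hl0⟩ := ((hslope.eventually_const_lt hr).and self_mem_nhdsWithin).exists
  refine ⟨l, hl0, ?_⟩
  rw [slope_def_field] at hl
  have hzero : ∀ x, ∑ y, W x y * Real.exp (-(0 : ℝ) * Real.log (W x y / W x0 y)) = 1 := by
    intro x
    simp [(hW x).2]
  simp only [hzero, sub_self, mul_zero, Finset.sum_const_zero, sub_zero] at hl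
  rw [lt_div_iff₀ hl0] at hl
  linarith

variable [DecidableEq Y]

lemma eventually_le_Kmax {W : X → Y → ℝ} {x0 : X} (hW : ∀ x, IsDist (W x))
    (hsupp : ∀ y, 0 < W x0 y) {g : Y → ℝ}
    (hg : ∀ x, relEnt (W x) (W x0) = ∑ y, W x y * g y)
    (hE : ∑ y, W x0 y * g y = 0) {α : X → ℝ} (hα : ∀ x, 0 ≤ α x)
    (hs : ∀ y, ∑ x ∈ Finset.univ.erase x0, α x * (W x y - W x0 y) = W x0 y * g y)
    {δ ε κ r v : ℝ} (hv : ∑ y, W x0 y * g y ^ 2 = v) (hε0 : 0 < ε) (hε : ε < 1) (hκ : 0 < κ)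
    (hκδ : κ ^ 2 * v / 2 < δ) (hr0 : 0 ≤ r) (hr : r < κ * v) :
    ∀ᶠ n : ℕ in atTop, r * Real.sqrt n ≤ Kmax W x0 δ ε n := by
  obtain ⟨r₁, hrr, hr₁⟩ := exists_between hr
  have hvα : ∑ x ∈ Finset.univ.erase x0, α x * relEnt (W x) (W x0) = v := by
    have h1 : ∀ x, relEnt (W x) (W x0) = ∑ y, g y * (W x y - W x0 y) := by
      intro x
      rw [hg, ← sub_zero (∑ y, W x y * g y), ← hE, ← Finset.sum_sub_distrib]
      exact Finset.sum_congr rfl fun y _ => by ring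
    simp_rw [h1, Finset.mul_sum]
    rw [Finset.sum_comm, ← hv]
    refine Finset.sum_congr rfl fun y _ => ?_
    simp_rw [mul_left_comm (α _)]
    rw [← Finset.mul_sum, hs]
    ring
  obtain ⟨l, hl0, hl⟩ := exists_pos_mul_lt_chernoff hW x0 α hvα hr₁
  set B := ∑ x ∈ Finset.univ.erase x0,
    α x * (1 - ∑ y, W x y * Real.exp (-l * Real.log (W x y / W x0 y))) with hB
  set M := ∑ y, W x0 y * |g y| ^ 3 with hM
  have hrel : ∀ᶠ n : ℕ in atTop, κ ^ 2 * v / 2 + 4 * κ ^ 3 * M / Real.sqrt n ≤ δ := by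
    have h := (tendsto_const_div_sqrt_natCast (4 * κ ^ 3 * M)).const_add (κ ^ 2 * v / 2)
    rw [add_zero] at h
    exact (h.eventually_lt_const hκδ).mono fun n hn => hn.le
  have hsqrt : Tendsto (fun n : ℕ => Real.sqrt n) atTop atTop :=
    Real.tendsto_sqrt_atTop.comp tendsto_natCast_atTop_atTop
  have hdecay : ∀ a : ℝ, 0 < a → Tendsto (fun n : ℕ => Real.exp (-(a * Real.sqrt n))) atTop
      (𝓝 0) := fun a ha =>
    Real.tendsto_exp_neg_atTop_nhds_zero.comp (hsqrt.const_mul_atTop ha)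
  have herr : ∀ᶠ n : ℕ in atTop, Real.exp (-((κ * B - l * r₁) * Real.sqrt n))
      + 2 * Real.exp (κ ^ 2 * v) * Real.exp (-((r₁ - r) * Real.sqrt n)) ≤ ε := by
    have h := (hdecay _ (sub_pos.mpr hl)).add
      ((hdecay _ (sub_pos.mpr hrr)).const_mul (2 * Real.exp (κ ^ 2 * v)))
    rw [mul_zero, add_zero] at h
    exact (h.eventually_lt_const hε0).mono fun n hn => hn.le
  have hmass : ∀ᶠ n : ℕ in atTop,
      κ / Real.sqrt n * ∑ z ∈ Finset.univ.erase x0, α z ≤ 1 := by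
    have h := (tendsto_const_div_sqrt_natCast κ).mul_const (∑ z ∈ Finset.univ.erase x0, α z)
    rw [zero_mul] at h
    exact (h.eventually_lt_const one_pos).mono fun n hn => hn.le
  filter_upwards [hrel, herr, hmass, eventually_gt_atTop 0,
    eventually_mul_abs_le g (tendsto_const_div_sqrt_natCast κ) one_half_pos]
    with n hrel herr hmass hn0 hng
  have hn' : (0 : ℝ) < n := by exact_mod_cast hn0
  have hsn : 0 < Real.sqrt n := Real.sqrt_pos.mpr hn'
  have hnsq : (n : ℝ) = Real.sqrt n ^ 2 := (Real.sq_sqrt hn'.le).symm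
  set η := κ / Real.sqrt n with hη
  have hη0 : 0 ≤ η := by positivity
  have hηn : (n : ℝ) * η ^ 2 = κ ^ 2 := by
    rw [hη, div_pow, Real.sq_sqrt hn'.le]
    field_simp
  have hP := isDist_perturbedInput x0 hα hη0 hmass
  have hexp1 : 1 ≤ Real.exp (r * Real.sqrt n) := Real.one_le_exp (by positivity)
  obtain ⟨m, hm⟩ : ∃ m : ℕ, m = ⌈Real.exp (r * Real.sqrt n)⌉₊ := ⟨_, rfl⟩
  have hmge : Real.exp (r * Real.sqrt n) ≤ m := hm ▸ Nat.le_ceil _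
  have hmle : (m : ℝ) ≤ 2 * Real.exp (r * Real.sqrt n) := by
    have := Nat.ceil_lt_add_one (Real.exp_pos (r * Real.sqrt n)).le
    rw [← hm] at this
    linarith
  have hm0 : 0 < m := by
    have : (0 : ℝ) < m := by linarith
    exact_mod_cast this
  obtain ⟨ρ, hρ, hout, hcerr⟩ := exists_random_code hW hsupp hP
    (Real.exp_pos (r₁ * Real.sqrt n)) hl0 n hm0
  have hQ : outDist (perturbedInput x0 α η) W = fun y => W x0 y * (1 + η * g y) := by
    funext y
    unfold outDist
    rw [sum_perturbedInput_mul x0 α η fun x => W x y, hs]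
    ring
  have hbdd : BddAbove {k : ℝ | ∃ m : ℕ, 0 < m ∧
      ∃ ρ : (Fin m → Fin n → X) × ((Fin n → Y) → Fin m) → ℝ,
        (∀ c, 0 ≤ ρ c) ∧ (∑ c, ρ c) = 1 ∧
        relEnt (codeOut W ρ) (fun ys : Fin n → Y => ∏ i, W x0 (ys i)) ≤ δ ∧
        codeErr W ρ ≤ ε ∧ k = Real.log m} :=
    ⟨_, fun k hk => le_of_mem_codeSizes hW hsupp hg hε one_pos n hk⟩
  have hlogm : r * Real.sqrt n ≤ Real.log m := by
    rw [← Real.log_exp (r * Real.sqrt n)]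
    exact Real.log_le_log (Real.exp_pos _) hmge
  refine hlogm.trans (le_csSup hbdd ⟨m, hm0, ρ, hρ.1, hρ.2, ?_, ?_, rfl⟩)
  · rw [hout, relEnt_pi_prod (fun _ => outDist (perturbedInput x0 α η) W) (fun _ => W x0)
      (fun _ => (hP.outDist hW).2) fun _ => hsupp, hQ, Finset.sum_const, Finset.card_univ,
      Fintype.card_fin, nsmul_eq_mul]
    have h1 := mul_le_mul_of_nonneg_left (relEnt_tilt_le (hW x0) hsupp hE hη0 hng) hn'.le
    refine h1.trans (le_trans (le_of_eq ?_) hrel)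
    rw [hv, ← hM]
    calc (n : ℝ) * (η ^ 2 * v / 2 + 4 * η ^ 3 * M)
        = (n * η ^ 2) * v / 2 + 4 * (n * η ^ 2) * η * M := by ring
      _ = _ := by rw [hηn, hη]; ring
  · refine hcerr.trans (le_trans (add_le_add ?_ ?_) herr)
    · set A := ∑ x, perturbedInput x0 α η x *
        ∑ y, W x y * Real.exp (-l * Real.log (W x y / W x0 y)) with hA
      have hA0 : 0 ≤ A := Finset.sum_nonneg fun x _ => mul_nonneg (hP.1 x)
        (Finset.sum_nonneg fun y _ => mul_nonneg ((hW x).1 y) (Real.exp_pos _).le)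
      have hx0 : ∑ y, W x0 y * Real.exp (-l * Real.log (W x0 y / W x0 y)) = 1 := by
        rw [← (hW x0).2]
        refine Finset.sum_congr rfl fun y _ => ?_
        rw [div_self (hsupp y).ne', Real.log_one, mul_zero, Real.exp_zero, mul_one]
      have hA1 : A = 1 - η * B := by
        rw [hA, sum_perturbedInput_mul x0 α η fun x =>
          ∑ y, W x y * Real.exp (-l * Real.log (W x y / W x0 y)), hx0, sub_eq_add_neg,
          ← mul_neg, hB, ← Finset.sum_neg_distrib]
        congr 2
        exact Finset.sum_congr rfl fun x _ => by ring
      have hA2 : A ^ n ≤ Real.exp (-(κ * B * Real.sqrt n)) := by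
        have h1 : A ≤ Real.exp (-(η * B)) := by
          have := Real.add_one_le_exp (-(η * B))
          linarith
        refine (pow_le_pow_left₀ hA0 h1 n).trans (le_of_eq ?_)
        rw [← Real.exp_nat_mul, hη]
        congr 1
        nth_rewrite 1 [hnsq]
        field_simp
      rw [← Real.exp_mul]
      refine (mul_le_mul_of_nonneg_left hA2 (Real.exp_pos _).le).trans (le_of_eq ?_)
      rw [← Real.exp_add]
      congr 1
      ring
    · have hS : ∑ y, outDist (perturbedInput x0 α η) W y ^ 2 / W x0 y = 1 + η ^ 2 * v := by
        have h1 : ∀ y, outDist (perturbedInput x0 α η) W y ^ 2 / W x0 y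
            = W x0 y + 2 * η * (W x0 y * g y) + η ^ 2 * (W x0 y * g y ^ 2) := by
          intro y
          rw [hQ]
          have := (hsupp y).ne'
          field_simp
          ring
        simp only [h1, Finset.sum_add_distrib, ← Finset.mul_sum, (hW x0).2, hE, hv]
        ring
      have hv0 : 0 ≤ v := hv ▸ Finset.sum_nonneg fun y _ =>
        mul_nonneg (hsupp y).le (sq_nonneg _)
      have hSn : (1 + η ^ 2 * v) ^ n ≤ Real.exp (κ ^ 2 * v) := by
        have h1 : 1 + η ^ 2 * v ≤ Real.exp (η ^ 2 * v) := by
          have := Real.add_one_le_exp (η ^ 2 * v)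
          linarith
        refine (pow_le_pow_left₀ (by positivity) h1 n).trans (le_of_eq ?_)
        rw [← Real.exp_nat_mul, ← mul_assoc, hηn]
      rw [hS]
      have h2 : (m : ℝ) / Real.exp (r₁ * Real.sqrt n)
          ≤ 2 * Real.exp (-((r₁ - r) * Real.sqrt n)) := by
        rw [div_le_iff₀ (Real.exp_pos _), mul_assoc, ← Real.exp_add]
        refine hmle.trans (le_of_eq ?_)
        congr 2
        ring
      refine (mul_le_mul h2 hSn (by positivity) (by positivity)).trans (le_of_eq ?_)
      ring

lemma le_liminf_Kmax {W : X → Y → ℝ} {x0 : X} (hW : ∀ x, IsDist (W x))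
    (hsupp : ∀ y, 0 < W x0 y) {g : Y → ℝ}
    (hg : ∀ x, relEnt (W x) (W x0) = ∑ y, W x y * g y)
    (hE : ∑ y, W x0 y * g y = 0) {α : X → ℝ} (hα : ∀ x, 0 ≤ α x)
    (hs : ∀ y, ∑ x ∈ Finset.univ.erase x0, α x * (W x y - W x0 y) = W x0 y * g y)
    {δ ε a v : ℝ} (hv : ∑ y, W x0 y * g y ^ 2 = v) (hδ : 0 < δ) (hε0 : 0 < ε) (hε : ε < 1)
    (ha0 : 0 ≤ a) (ha : a < Real.sqrt (2 * v)) :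
    (a : EReal) ≤
      liminf (fun n : ℕ => ((Kmax W x0 δ ε n / Real.sqrt (n * δ) : ℝ) : EReal)) atTop := by
  have hv0 : 0 < v := by
    have := Real.sqrt_pos.mp (lt_of_le_of_lt ha0 ha)
    linarith
  have hd : 0 < Real.sqrt δ := Real.sqrt_pos.mpr hδ
  have hsq : Real.sqrt (2 * v) ^ 2 = 2 * v := Real.sq_sqrt (by positivity)
  have hdsq : Real.sqrt δ ^ 2 = δ := Real.sq_sqrt hδ.le
  obtain ⟨b, hab, hb⟩ := exists_between ha
  have hb0 : 0 < b := lt_of_le_of_lt ha0 hab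
  have hb2 : b ^ 2 < 2 * v := by
    rw [← hsq]
    exact pow_lt_pow_left₀ hb hb0.le two_ne_zero
  have h := eventually_le_Kmax hW hsupp hg hE hα hs (δ := δ) (κ := b * Real.sqrt δ / v)
    (r := a * Real.sqrt δ) hv hε0 hε (by positivity) ?_ (by positivity) ?_
  · refine le_liminf_of_le (by isBoundedDefault) ?_
    filter_upwards [h, eventually_gt_atTop 0] with n hn hn0
    have hn' : (0 : ℝ) < n := by exact_mod_cast hn0
    have hsn : 0 < Real.sqrt n := Real.sqrt_pos.mpr hn'
    rw [EReal.coe_le_coe_iff, Real.sqrt_mul hn'.le, le_div_iff₀ (by positivity)]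
    linarith
  · have e : (b * Real.sqrt δ / v) ^ 2 * v / 2 = b ^ 2 * δ / (2 * v) := by
      rw [div_pow, mul_pow, hdsq]
      field_simp
    rw [e, div_lt_iff₀ (by positivity)]
    nlinarith
  · rw [div_mul_cancel₀ _ hv0.ne']
    exact mul_lt_mul_of_pos_right hab hd

lemma IsL.eq_sqrt {W : X → Y → ℝ} {x0 : X} (hW : ∀ x, IsDist (W x))
    (hsupp : ∀ y, 0 < W x0 y) {g : Y → ℝ}
    (hg : ∀ x, relEnt (W x) (W x0) = ∑ y, W x y * g y)
    (hE : ∑ y, W x0 y * g y = 0) {α : X → ℝ} (hα : ∀ x, 0 ≤ α x)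
    (hs : ∀ y, ∑ x ∈ Finset.univ.erase x0, α x * (W x y - W x0 y) = W x0 y * g y)
    {δ v : ℝ} (hv : ∑ y, W x0 y * g y ^ 2 = v) (hδ : 0 < δ) {L : EReal} (hL : IsL W x0 δ L) :
    L = (Real.sqrt (2 * v) : EReal) := by
  have hv0 : 0 ≤ v := hv ▸ Finset.sum_nonneg fun y _ => mul_nonneg (hsupp y).le (sq_nonneg _)
  have hsmall : ∀ᶠ ε : ℝ in 𝓝[>] 0, 0 < ε ∧ ε < 1 := Ioo_mem_nhdsGT one_pos
  refine le_antisymm (EReal.le_of_forall_lt_iff_le.mp fun z hz => ?_)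
    (EReal.ge_of_forall_gt_iff_ge.mp fun z hz => ?_)
  · rw [EReal.coe_lt_coe_iff] at hz
    have hz0 : 0 < z := lt_of_le_of_lt (Real.sqrt_nonneg _) hz
    have hz2 : 2 * v ≤ z ^ 2 := by
      rw [← Real.sq_sqrt (by positivity : 0 ≤ 2 * v)]
      exact pow_le_pow_left₀ (Real.sqrt_nonneg _) hz.le 2
    have hlim : Tendsto (fun ε : ℝ => (((1 / (2 / z) + 2 / z * v / 2) / (1 - ε) : ℝ) : EReal))
        (𝓝[>] 0) (𝓝 ((1 / (2 / z) + 2 / z * v / 2 : ℝ) : EReal)) := by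
      refine (continuous_coe_real_ereal.tendsto _).comp (tendsto_nhdsWithin_of_tendsto_nhds ?_)
      have : ContinuousAt (fun ε : ℝ => (1 / (2 / z) + 2 / z * v / 2) / (1 - ε)) 0 :=
        continuousAt_const.div (continuousAt_const.sub continuousAt_id) (by simp)
      simpa [ContinuousAt] using this
    refine (le_of_tendsto_of_tendsto hL hlim (hsmall.mono fun ε hε => ?_)).trans ?_
    · have := liminf_Kmax_le hW hsupp hg hE hδ hε.2 (div_pos two_pos hz0)
      rwa [hv] at this
    · rw [EReal.coe_le_coe_iff]
      have e : 1 / (2 / z) + 2 / z * v / 2 = (z ^ 2 + 2 * v) / (2 * z) := by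
        field_simp
      rw [e, div_le_iff₀ (by positivity)]
      nlinarith
  · rw [EReal.coe_lt_coe_iff] at hz
    refine ge_of_tendsto hL (hsmall.mono fun ε hε => ?_)
    rcases lt_or_ge z 0 with hz0 | hz0
    · refine le_liminf_of_le (by isBoundedDefault) (Eventually.of_forall fun n => ?_)
      rw [EReal.coe_le_coe_iff]
      refine hz0.le.trans (div_nonneg (Real.sSup_nonneg ?_) (Real.sqrt_nonneg _))
      rintro k ⟨m, -, -, -, -, -, -, rfl⟩
      exact Real.log_natCast_nonneg m
    · exact le_liminf_Kmax hW hsupp hg hE hα hs hv hδ hε.1 hε.2 hz0 hz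

end Lower

/-!
STATEMENT 7: Under the condition of Statement 6 (a capacity-achieving input
distribution with full support), with `C` the capacity, `Q*` the capacity-achieving
output distribution, and `s(y) = Q0(y)(log(Q*(y)/Q0(y)) + C)`: if the linear system
`Σ_{x≠x0} α_x (W(·|x) − Q0) = s` has a nonnegative solution, then
`L = √(2 · var_{Q0}(log(Q0(Y)/Q*(Y))))`.
-/

theorem statement7 {X Y : Type*} [Fintype X] [Fintype Y] [DecidableEq X] [DecidableEq Y]
    (W : X → Y → ℝ) (x0 : X) (hW : ∀ x, IsDist (W x)) (hsupp : ∀ y, 0 < W x0 y)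
    (Pstar : X → ℝ) (hPstar : IsDist Pstar) (hfull : ∀ x, 0 < Pstar x)
    (hcap : ∀ P : X → ℝ, IsDist P → mutInfo P W ≤ mutInfo Pstar W)
    (α : X → ℝ) (hαnonneg : ∀ x, 0 ≤ α x)
    (hsys : ∀ y, ∑ x ∈ Finset.univ.erase x0, α x * (W x y - W x0 y) =
      W x0 y * (Real.log (outDist Pstar W y / W x0 y) + mutInfo Pstar W))
    (δ : ℝ) (hδ : 0 < δ) (L : EReal) (hL : IsL W x0 δ L) :
    L = ((Real.sqrt (2 * varFin (W x0)
      (fun y => Real.log (W x0 y / outDist Pstar W y))) : ℝ) : EReal) := by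
  have hout : ∀ y, 0 < outDist Pstar W y := fun y =>
    (mul_pos (hfull x0) (hsupp y)).trans_le (Finset.single_le_sum
      (f := fun x => Pstar x * W x y) (fun x _ => mul_nonneg (hPstar.1 x) ((hW x).1 y))
      (Finset.mem_univ x0))
  have hkkt := relEnt_outDist_eq_capacity W hW Pstar hPstar hfull hout hcap
  set C := mutInfo Pstar W
  set Q := outDist Pstar W
  have hg : ∀ x, relEnt (W x) (W x0) = ∑ y, W x y * (Real.log (Q y / W x0 y) + C) := by
    intro x
    simp only [mul_add, Finset.sum_add_distrib, ← Finset.sum_mul, (hW x).2, one_mul]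
    rw [← hkkt x, relEnt, relEnt, ← Finset.sum_add_distrib]
    refine Finset.sum_congr rfl fun y _ => ?_
    by_cases h0 : W x y = 0
    · simp [h0]
    · rw [Real.log_div h0 (hsupp y).ne', Real.log_div h0 (hout y).ne',
        Real.log_div (hout y).ne' (hsupp y).ne']
      ring
  have hE : ∑ y, W x0 y * (Real.log (Q y / W x0 y) + C) = 0 := by
    rw [← hg x0, relEnt]
    exact Finset.sum_eq_zero fun y _ => by rw [div_self (hsupp y).ne', Real.log_one, mul_zero]
  have hmean : ∑ y, W x0 y * Real.log (W x0 y / Q y) = C := hkkt x0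
  refine IsL.eq_sqrt hW hsupp hg hE hαnonneg hsys ?_ hδ hL
  unfold varFin
  rw [hmean]
  refine Finset.sum_congr rfl fun y _ => ?_
  rw [← inv_div (W x0 y), Real.log_inv]
  ring
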